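/- arXiv:2502.13639 — 4 statements merged into one kernel-verified Lean document; each statement's English description precedes it below -/
import Mathlib

section
/- Two pairs (C,F) and (C',F'), each consisting of C : Ω → ℝ and a minimal F : Ω → ℝⁿ, determine the same exponential family (i.e. E_{C,F} = E_{C',F'} as subsets of Ω → ℝ) if and only if there exist an invertible matrix A ∈ GL(n,ℝ), vectors u, v ∈ ℝⁿ and a scalar c ∈ ℝ such that C(x) = C'(x) + ⟨u, F'(x)⟩ + c for all x ∈ Ω and F(x) = A·F'(x) + v for all x ∈ Ω. -/
open scoped BigOperators

/-- Log-partition function `ψ_{C,F}(θ) = log ∑_{x∈Ω} exp(C x + ⟨θ, F x⟩)`. -/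
noncomputable def logPartition {Ω : Type*} [Fintype Ω] {n : ℕ}
    (C : Ω → ℝ) (F : Ω → Fin n → ℝ) (θ : Fin n → ℝ) : ℝ :=
  Real.log (∑ x : Ω, Real.exp (C x + ∑ i, θ i * F x i))

/-- The density `p_{C,F}(x;θ) = exp(C x + ⟨θ, F x⟩ − ψ_{C,F}(θ))`. -/
noncomputable def expPdf {Ω : Type*} [Fintype Ω] {n : ℕ}
    (C : Ω → ℝ) (F : Ω → Fin n → ℝ) (θ : Fin n → ℝ) (x : Ω) : ℝ :=
  Real.exp (C x + (∑ i, θ i * F x i) - logPartition C F θ)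

/-- The exponential family `E_{C,F} = {p_{C,F}(·;θ) : θ ∈ ℝⁿ} ⊆ (Ω → ℝ)`. -/
noncomputable def expFam {Ω : Type*} [Fintype Ω] {n : ℕ}
    (C : Ω → ℝ) (F : Ω → Fin n → ℝ) : Set (Ω → ℝ) :=
  {p | ∃ θ : Fin n → ℝ, p = fun x => expPdf C F θ x}

/-- `(C,F)` is minimal when `1, F₁, …, Fₙ` are linearly independent in `Ω → ℝ`. -/
def IsMinimal {Ω : Type*} {n : ℕ} (F : Ω → Fin n → ℝ) : Prop :=
  LinearIndependent ℝ
    (Fin.cons (fun _ => (1 : ℝ)) (fun i x => F x i) : Fin (n + 1) → Ω → ℝ)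

/-- Exponents differing by a constant normalise to the same density. -/
theorem expPdf_eq_iff {Ω : Type*} [Fintype Ω] [Nonempty Ω] {m n : ℕ}
    (C C' : Ω → ℝ) (F : Ω → Fin m → ℝ) (F' : Ω → Fin n → ℝ)
    (θ : Fin m → ℝ) (θ' : Fin n → ℝ) :
    expPdf C F θ = expPdf C' F' θ' ↔
      ∃ c : ℝ, ∀ x, C x + ∑ i, θ i * F x i = C' x + (∑ i, θ' i * F' x i) + c := by
  constructor
  · intro h
    refine ⟨logPartition C F θ - logPartition C' F' θ', fun x => ?_⟩
    have := Real.exp_injective (congrFun h x)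
    linarith
  · rintro ⟨c, h⟩
    have hL : logPartition C F θ = logPartition C' F' θ' + c := by
      simp only [logPartition, h]
      simp_rw [Real.exp_add _ c, ← Finset.sum_mul]
      rw [Real.log_mul _ (Real.exp_ne_zero _), Real.log_exp]
      exact (Finset.sum_pos (fun _ _ => Real.exp_pos _) Finset.univ_nonempty).ne'
    funext x
    simp only [expPdf, hL, h]
    congr 1
    ring

theorem IsMinimal.eq_zero_of_sum_eq_const {Ω : Type*} {n : ℕ} {F : Ω → Fin n → ℝ}
    (hF : IsMinimal F) {w : Fin n → ℝ} {d : ℝ} (h : ∀ x, ∑ i, w i * F x i = d) : w = 0 := by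
  have key := Fintype.linearIndependent_iff.1 hF (Fin.cons (-d) w) (by
    funext x
    simp [Fin.sum_univ_succ, h])
  funext i
  simpa using key i.succ

theorem sum_mul_affine {n m : ℕ} (A : Matrix (Fin n) (Fin m) ℝ) (θ v : Fin n → ℝ)
    (y : Fin m → ℝ) :
    ∑ i, θ i * ((∑ j, A i j * y j) + v i) =
      (∑ j, Matrix.vecMul θ A j * y j) + ∑ i, θ i * v i := by
  simp only [mul_add, Finset.sum_add_distrib]
  congr 1
  exact Matrix.dotProduct_mulVec θ A y

/-- An affine change of the pair `(C, F)` acts affinely on the parameter. -/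
theorem expPdf_eq_of_affine {Ω : Type*} [Fintype Ω] [Nonempty Ω] {n m : ℕ}
    {C C' : Ω → ℝ} {F : Ω → Fin n → ℝ} {F' : Ω → Fin m → ℝ}
    {A : Matrix (Fin n) (Fin m) ℝ} {u : Fin m → ℝ} {v : Fin n → ℝ} {c : ℝ}
    (hC : ∀ x, C x = C' x + (∑ i, u i * F' x i) + c)
    (hFA : ∀ x, ∀ i, F x i = (∑ j, A i j * F' x j) + v i) (θ : Fin n → ℝ) :
    expPdf C F θ = expPdf C' F' (u + Matrix.vecMul θ A) := by
  refine (expPdf_eq_iff ..).2 ⟨c + ∑ i, θ i * v i, fun x => ?_⟩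
  simp only [hC, hFA, sum_mul_affine, Pi.add_apply, add_mul, Finset.sum_add_distrib]
  ring

theorem IsMinimal.isUnit_of_affine {Ω : Type*} {n : ℕ} {F F' : Ω → Fin n → ℝ}
    (hF : IsMinimal F) {A : Matrix (Fin n) (Fin n) ℝ} {v : Fin n → ℝ}
    (hFA : ∀ x, ∀ i, F x i = (∑ j, A i j * F' x j) + v i) : IsUnit A := by
  rw [← Matrix.vecMul_injective_iff_isUnit]
  refine (injective_iff_map_eq_zero A.vecMulLinear).2 fun w hw => ?_
  have hw' : Matrix.vecMul w A = 0 := hw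
  refine hF.eq_zero_of_sum_eq_const (d := ∑ i, w i * v i) fun x => ?_
  simp [hFA, sum_mul_affine, hw']

/-- Two minimal pairs `(C,F)` and `(C',F')` determine the same exponential family
iff they are related by an element of the group `G_n`. -/
theorem expFam_eq_iff_group_related {Ω : Type*} [Fintype Ω] [Nonempty Ω] {n : ℕ}
    (C C' : Ω → ℝ) (F F' : Ω → Fin n → ℝ)
    (hF : IsMinimal F) (hF' : IsMinimal F') :
    expFam C F = expFam C' F' ↔
      ∃ (A : Matrix (Fin n) (Fin n) ℝ) (u v : Fin n → ℝ) (c : ℝ),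
        IsUnit A ∧
        (∀ x : Ω, C x = C' x + (∑ i, u i * F' x i) + c) ∧
        (∀ x : Ω, ∀ i, F x i = (∑ j, A i j * F' x j) + v i) := by
  constructor
  · intro h
    have hsub (θ : Fin n → ℝ) : ∃ θ' : Fin n → ℝ, ∃ c : ℝ, ∀ x,
        C x + ∑ i, θ i * F x i = C' x + (∑ i, θ' i * F' x i) + c := by
      obtain ⟨θ', hθ'⟩ : expPdf C F θ ∈ expFam C' F' := h ▸ ⟨θ, rfl⟩
      exact ⟨θ', (expPdf_eq_iff ..).1 hθ'⟩
    obtain ⟨u, c, hC⟩ := hsub 0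
    simp only [Pi.zero_apply, zero_mul, Finset.sum_const_zero, add_zero] at hC
    choose B d hB using fun i => hsub (Pi.single i 1)
    have hFA : ∀ x, ∀ i, F x i = (∑ j, Matrix.of (fun i j => B i j - u j) i j * F' x j)
        + (d i - c) := by
      intro x i
      have hi := hB i x
      simp only [Pi.single_apply, ite_mul, one_mul, zero_mul, Finset.sum_ite_eq',
        Finset.mem_univ, if_true] at hi
      simp only [Matrix.of_apply, sub_mul, Finset.sum_sub_distrib]
      linarith [hC x]
    exact ⟨_, u, fun i => d i - c, c, hF.isUnit_of_affine hFA, hC, hFA⟩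
  · rintro ⟨A, u, v, c, hA, hC, hFA⟩
    ext p
    constructor
    · rintro ⟨θ, rfl⟩
      exact ⟨_, expPdf_eq_of_affine hC hFA θ⟩
    · rintro ⟨θ', rfl⟩
      obtain ⟨θ, hθ⟩ := Matrix.vecMul_surjective_iff_isUnit.2 hA (θ' - u)
      refine ⟨θ, ((expPdf_eq_of_affine hC hFA θ).trans ?_).symm⟩
      rw [show Matrix.vecMul θ A = θ' - u from hθ, add_sub_cancel]
end

section
/- The action of Aff(n,ℝ)† on V × Stief_n(V) is proper in the following sequential sense: let (A_k, x_k) be a sequence with A_k ∈ GL(n,ℝ) and x_k ∈ ℝⁿ, and let (v₀ᵏ, Fᵏ) be a sequence in V × Vⁿ with each Fᵏ linearly independent, converging to (v₀*, F*) with F* linearly independent. If the transformed sequence (v₀ᵏ + ⟨x_k, Fᵏ⟩, A_kFᵏ) converges to a pair (w*, H*) with H* linearly independent, then there is a subsequence along which A_k converges in the space of n×n matrices to an invertible matrix and x_k converges in ℝⁿ. -/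
open scoped BigOperators Topology
open Filter

/-- Coordinates with respect to a convergent sequence of frames with linearly independent limit
converge as soon as the represented vectors do. -/
theorem tendsto_frame_coordinates {V : Type*} [NormedAddCommGroup V] [NormedSpace ℝ V]
    [FiniteDimensional ℝ V] {n : ℕ} {F : ℕ → Fin n → V} {F' : Fin n → V}
    (hF' : LinearIndependent ℝ F') (hF : Tendsto F atTop (𝓝 F'))
    {c : ℕ → Fin n → ℝ} {u : V} (hc : Tendsto (fun k => ∑ j, c k j • F k j) atTop (𝓝 u)) :
    ∃ c' : Fin n → ℝ, Tendsto c atTop (𝓝 c') := by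
  obtain ⟨g, hg⟩ := (Fintype.linearCombination ℝ F').exists_leftInverse_of_injective
    (LinearMap.ker_eq_bot.2 hF'.fintypeLinearCombination_injective)
  have hgcont : Continuous g := g.continuous_of_finiteDimensional
  have hgF' : Matrix.of (fun j => g (F' j)) = (1 : Matrix (Fin n) (Fin n) ℝ) := by
    ext j i
    have h := LinearMap.congr_fun hg (Pi.single j 1)
    rw [LinearMap.comp_apply, Fintype.linearCombination_apply_single, one_smul] at h
    simp [h, Matrix.one_apply, Pi.single_apply, eq_comm]
  set M : ℕ → Matrix (Fin n) (Fin n) ℝ := fun k => Matrix.of fun j => g (F k j)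
  have hM : Tendsto M atTop (𝓝 1) := by
    rw [← hgF']
    exact tendsto_pi_nhds.2 fun j => (hgcont.tendsto _).comp (tendsto_pi_nhds.1 hF j)
  have hdet : ∀ᶠ k in atTop, IsUnit (M k).det := by
    have h : Tendsto (fun k => (M k).det) atTop (𝓝 1) := by
      simpa [Function.comp_def] using ((continuous_id.matrix_det).tendsto (1 : Matrix (Fin n) (Fin n) ℝ)).comp hM
    filter_upwards [h.eventually_ne one_ne_zero] with k hk using hk.isUnit
  have hMinv : Tendsto (fun k => (M k)⁻¹) atTop (𝓝 1) := by
    have h : ContinuousAt Inv.inv (1 : Matrix (Fin n) (Fin n) ℝ) := by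
      apply continuousAt_matrix_inv
      rw [Ring.inverse_eq_inv']
      exact continuousAt_inv₀ (by simp)
    simpa [Function.comp_def] using h.tendsto.comp hM
  have hcM : ∀ k, Matrix.vecMul (c k) (M k) = g (∑ j, c k j • F k j) := by
    intro k
    ext i
    simp [M, Matrix.vecMul, dotProduct, map_sum]
  have hlim : Tendsto (fun k => Matrix.vecMul (g (∑ j, c k j • F k j)) (M k)⁻¹) atTop
      (𝓝 (Matrix.vecMul (g u) 1)) := by
    have hcont : Continuous fun p : (Fin n → ℝ) × Matrix (Fin n) (Fin n) ℝ =>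
        Matrix.vecMul p.1 p.2 := continuous_fst.matrix_vecMul continuous_snd
    exact (hcont.tendsto (g u, 1)).comp (((hgcont.tendsto u).comp hc).prodMk_nhds hMinv)
  refine ⟨_, hlim.congr' ?_⟩
  filter_upwards [hdet] with k hk
  rw [← hcM, Matrix.vecMul_vecMul, Matrix.mul_nonsing_inv _ hk, Matrix.vecMul_one]

/-- Sequential properness of the `Aff(n,ℝ)†`-action on `V × Stief_n(V)`: if `(v₀ᵏ,Fᵏ)` are
pairs with `Fᵏ` linearly independent converging to `(v₀*,F*)` with `F*` linearly
independent, and the transformed pairs `(v₀ᵏ + ⟨x_k,Fᵏ⟩, A_kFᵏ)` converge to `(w*,H*)`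
with `H*` linearly independent, then along a subsequence `A_k` converges to an invertible
matrix and `x_k` converges. -/
theorem aff_action_proper {V : Type*} [NormedAddCommGroup V] [NormedSpace ℝ V]
    [FiniteDimensional ℝ V] {n : ℕ}
    (A : ℕ → Matrix (Fin n) (Fin n) ℝ) (hA : ∀ k, IsUnit (A k)) (x : ℕ → Fin n → ℝ)
    (v₀ : ℕ → V) (F : ℕ → Fin n → V) (hF : ∀ k, LinearIndependent ℝ (F k))
    (v₀star : V) (Fstar : Fin n → V) (hFstar : LinearIndependent ℝ Fstar)
    (hv₀conv : Tendsto v₀ atTop (𝓝 v₀star))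
    (hFconv : Tendsto F atTop (𝓝 Fstar))
    (wstar : V) (Hstar : Fin n → V) (hHstar : LinearIndependent ℝ Hstar)
    (hwconv : Tendsto (fun k => v₀ k + ∑ i, x k i • F k i) atTop (𝓝 wstar))
    (hHconv : Tendsto (fun k => fun i : Fin n => ∑ j, A k i j • F k j) atTop (𝓝 Hstar)) :
    ∃ φ : ℕ → ℕ, StrictMono φ ∧
      ∃ (Astar : Matrix (Fin n) (Fin n) ℝ) (xstar : Fin n → ℝ),
        IsUnit Astar ∧
        Tendsto (fun k => A (φ k)) atTop (𝓝 Astar) ∧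
        Tendsto (fun k => x (φ k)) atTop (𝓝 xstar) := by
  have hrow : ∀ i, ∃ a : Fin n → ℝ, Tendsto (fun k => A k i) atTop (𝓝 a) := fun i =>
    tendsto_frame_coordinates hFstar hFconv (tendsto_pi_nhds.1 hHconv i)
  choose Astar hAstar using hrow
  obtain ⟨xstar, hxstar⟩ := tendsto_frame_coordinates (c := x) (u := wstar - v₀star)
    hFstar hFconv (by simpa using hwconv.sub hv₀conv)
  refine ⟨id, strictMono_id, Matrix.of Astar, xstar, ?_, tendsto_pi_nhds.2 hAstar, hxstar⟩
  have hH : ∀ i, Fintype.linearCombination ℝ Fstar (Astar i) = Hstar i := fun i =>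
    tendsto_nhds_unique
      (tendsto_finsetSum _ fun j _ =>
        (tendsto_pi_nhds.1 (hAstar i) j).smul (tendsto_pi_nhds.1 hFconv j))
      (tendsto_pi_nhds.1 hHconv i)
  rw [← Matrix.linearIndependent_rows_iff_isUnit]
  refine LinearIndependent.of_comp (Fintype.linearCombination ℝ Fstar) ?_
  have hcomp : Fintype.linearCombination ℝ Fstar ∘ (Matrix.of Astar).row = Hstar := funext hH
  rwa [hcomp]
end

section
/- The map sending a pair (C,F), with C : Ω → ℝ and F : Ω → ℝⁿ minimal, to the affine subset [C] + span{[F₁],…,[Fₙ]} of the quotient space (Ω → ℝ)/ℝ induces a bijection from the set of G_n-orbits of minimal pairs onto the set of n-dimensional affine subsets of (Ω → ℝ)/ℝ; that is, two minimal pairs lie in the same G_n-orbit if and only if they have the same image, and every n-dimensional affine subset of (Ω → ℝ)/ℝ is an image. -/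
open scoped BigOperators

/-- The subspace of constant functions on `Ω`, identified with `ℝ`. -/
def constFuns (Ω : Type*) : Submodule ℝ (Ω → ℝ) :=
  Submodule.span ℝ {fun _ => (1 : ℝ)}

/-- The affine subset `[C] + span{[F₁],…,[Fₙ]}` of the quotient `(Ω → ℝ)/ℝ`. -/
def affClass {Ω : Type*} {n : ℕ} (C : Ω → ℝ) (F : Ω → Fin n → ℝ) :
    Set ((Ω → ℝ) ⧸ constFuns Ω) :=
  {y | ∃ z ∈ Submodule.span ℝ
        (Set.range (fun i => (Submodule.Quotient.mk (fun x => F x i) :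
          (Ω → ℝ) ⧸ constFuns Ω))),
    y = Submodule.Quotient.mk C + z}

theorem mkQ_constFuns_eq_iff {Ω : Type*} (f g : Ω → ℝ) :
    (constFuns Ω).mkQ f = (constFuns Ω).mkQ g ↔ ∃ c : ℝ, ∀ x, f x = g x + c := by
  rw [Submodule.mkQ_apply, Submodule.mkQ_apply, Submodule.Quotient.eq, constFuns,
    Submodule.mem_span_singleton]
  refine exists_congr fun c => ⟨fun h x => ?_, fun h => funext fun x => ?_⟩
  · have := congrFun h x
    simp only [Pi.smul_apply, Pi.sub_apply, smul_eq_mul, mul_one] at this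
    linarith
  · simp only [Pi.smul_apply, Pi.sub_apply, smul_eq_mul, mul_one]
    linarith [h x]

/-- The classes `[F₁],…,[Fₙ]` of the components of `F` modulo constant functions. -/
def componentClass {Ω : Type*} {n : ℕ} (F : Ω → Fin n → ℝ) (i : Fin n) :
    (Ω → ℝ) ⧸ constFuns Ω :=
  (constFuns Ω).mkQ fun x => F x i

theorem sum_smul_componentClass {Ω : Type*} {n : ℕ} (F : Ω → Fin n → ℝ) (u : Fin n → ℝ) :
    ∑ i, u i • componentClass F i = (constFuns Ω).mkQ fun x => ∑ i, u i * F x i := by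
  simp only [componentClass, ← map_smul, ← map_sum]
  congr 1
  ext x
  simp

theorem isMinimal_iff_linearIndependent {Ω : Type*} [Nonempty Ω] {n : ℕ}
    (F : Ω → Fin n → ℝ) : IsMinimal F ↔ LinearIndependent ℝ (componentClass F) := by
  rw [IsMinimal, Fintype.linearIndependent_iff, Fintype.linearIndependent_iff]
  constructor
  · intro h g hg i
    rw [sum_smul_componentClass, ← map_zero (constFuns Ω).mkQ, mkQ_constFuns_eq_iff] at hg
    obtain ⟨c, hc⟩ := hg
    have := h (Fin.cons (-c) g) (by
      ext x
      simp [Fin.sum_univ_succ, hc x]) i.succ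
    simpa using this
  · intro h g hg
    have hx : ∀ x, g 0 + ∑ i : Fin n, g i.succ * F x i = 0 := fun x => by
      simpa [Fin.sum_univ_succ] using congrFun hg x
    have hs : ∀ i : Fin n, g i.succ = 0 := h (fun i => g i.succ) (by
      rw [sum_smul_componentClass, ← map_zero (constFuns Ω).mkQ, mkQ_constFuns_eq_iff]
      refine ⟨-g 0, fun x => ?_⟩
      simp only [Pi.zero_apply]
      linarith [hx x])
    have h0 : g 0 = 0 := by simpa [hs] using hx (Classical.arbitrary Ω)
    exact Fin.cases h0 hs

theorem translate_eq_translate_iff {V : Type*} [AddCommGroup V] [Module ℝ V] (w w' : V)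
    (W W' : Submodule ℝ V) :
    {y | ∃ z ∈ W, y = w + z} = {y | ∃ z ∈ W', y = w' + z} ↔ W = W' ∧ w' - w ∈ W := by
  have hmem : ∀ (p y : V) (U : Submodule ℝ V), (∃ z ∈ U, y = p + z) ↔ y - p ∈ U :=
    fun p y U => ⟨by rintro ⟨z, hz, rfl⟩; simpa using hz, fun h => ⟨_, h, by abel⟩⟩
  simp only [hmem, Set.ext_iff, Set.mem_ofPred_eq]
  constructor
  · intro h
    have hw : w' - w ∈ W := (h w').2 (by simp)
    refine ⟨Submodule.ext fun z => ?_, hw⟩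
    have := h (w' + z)
    rw [add_sub_cancel_left, show w' + z - w = (w' - w) + z by abel,
      W.add_mem_iff_right hw] at this
    exact this
  · rintro ⟨rfl, hw⟩ y
    rw [← W.sub_mem_iff_left hw, show y - w - (w' - w) = y - w' by abel]

theorem affClass_eq {Ω : Type*} {n : ℕ} (C : Ω → ℝ) (F : Ω → Fin n → ℝ) :
    affClass C F = {y | ∃ z ∈ Submodule.span ℝ (Set.range (componentClass F)),
      y = (constFuns Ω).mkQ C + z} :=
  rfl

theorem span_eq_span_iff_exists_matrix {V : Type*} [AddCommGroup V] [Module ℝ V] {n : ℕ}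
    {b b' : Fin n → V} (hb : LinearIndependent ℝ b) (hb' : LinearIndependent ℝ b') :
    Submodule.span ℝ (Set.range b) = Submodule.span ℝ (Set.range b') ↔
      ∃ A : Matrix (Fin n) (Fin n) ℝ, IsUnit A ∧ ∀ i, b' i = ∑ j, A i j • b j := by
  constructor
  · intro h
    have hA : ∀ i, ∃ a : Fin n → ℝ, ∑ j, a j • b j = b' i := fun i => by
      rw [← Submodule.mem_span_range_iff_exists_fun, h]
      exact Submodule.subset_span ⟨i, rfl⟩
    choose A hA using hA
    refine ⟨Matrix.of A, ?_, fun i => (hA i).symm⟩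
    rw [← Matrix.linearIndependent_rows_iff_isUnit, Fintype.linearIndependent_iff]
    intro g hg
    refine Fintype.linearIndependent_iff.1 hb' g ?_
    simp only [← hA, Finset.smul_sum, smul_smul]
    rw [Finset.sum_comm]
    refine Finset.sum_eq_zero fun j _ => ?_
    rw [← Finset.sum_smul]
    have := congrFun hg j
    simp only [Finset.sum_apply, Pi.smul_apply, smul_eq_mul, Pi.zero_apply, Matrix.row_apply,
      Matrix.of_apply] at this
    rw [this, zero_smul]
  · rintro ⟨A, -, hA⟩
    have := FiniteDimensional.span_of_finite ℝ (Set.finite_range b)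
    refine (Submodule.eq_of_le_of_finrank_eq ?_ ?_).symm
    · rw [Submodule.span_le]
      rintro _ ⟨i, rfl⟩
      exact Submodule.mem_span_range_iff_exists_fun ℝ |>.2 ⟨A i, (hA i).symm⟩
    · rw [finrank_span_eq_card hb, finrank_span_eq_card hb']

/-- The map `(C,F) ↦ [C] + span{[F₁],…,[Fₙ]}` induces a bijection from the set of
`G_n`-orbits of minimal pairs onto the set of `n`-dimensional affine subsets of
`(Ω → ℝ)/ℝ`: two minimal pairs lie in the same `G_n`-orbit iff they have the same image,
and every `n`-dimensional affine subset `w + W` is an image. -/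
theorem Gn_orbits_bijection_affine {Ω : Type*} [Fintype Ω] [Nonempty Ω] {n : ℕ} :
    (∀ (C C' : Ω → ℝ) (F F' : Ω → Fin n → ℝ), IsMinimal F → IsMinimal F' →
      ((∃ (A : Matrix (Fin n) (Fin n) ℝ) (u v : Fin n → ℝ) (c : ℝ), IsUnit A ∧
          (∀ x : Ω, C' x = C x + (∑ i, u i * F x i) + c) ∧
          (∀ x : Ω, ∀ i, F' x i = (∑ j, A i j * F x j) + v i)) ↔
        affClass C F = affClass C' F')) ∧
    (∀ (w : (Ω → ℝ) ⧸ constFuns Ω) (W : Submodule ℝ ((Ω → ℝ) ⧸ constFuns Ω)),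
      Module.finrank ℝ W = n →
      ∃ (C : Ω → ℝ) (F : Ω → Fin n → ℝ), IsMinimal F ∧
        affClass C F = {y | ∃ z ∈ W, y = w + z}) := by
  refine ⟨fun C C' F F' hF hF' => ?_, fun w W hW => ?_⟩
  · rw [isMinimal_iff_linearIndependent] at hF hF'
    rw [affClass_eq, affClass_eq, translate_eq_translate_iff,
      span_eq_span_iff_exists_matrix hF hF', Submodule.mem_span_range_iff_exists_fun]
    have hC : ∀ u : Fin n → ℝ, ∑ i, u i • componentClass F i =
        (constFuns Ω).mkQ C' - (constFuns Ω).mkQ C ↔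
        ∃ c : ℝ, ∀ x, C' x = C x + (∑ i, u i * F x i) + c := fun u => by
      rw [sum_smul_componentClass, eq_sub_iff_add_eq', ← map_add, eq_comm,
        mkQ_constFuns_eq_iff]
      rfl
    have hA : ∀ (A : Matrix (Fin n) (Fin n) ℝ) (i : Fin n),
        componentClass F' i = ∑ j, A i j • componentClass F j ↔
        ∃ v : ℝ, ∀ x, F' x i = (∑ j, A i j * F x j) + v := fun A i => by
      rw [sum_smul_componentClass, componentClass, mkQ_constFuns_eq_iff]
    simp only [hC, hA]
    constructor
    · rintro ⟨A, u, v, c, hu, h, h'⟩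
      exact ⟨⟨A, hu, fun i => ⟨v i, fun x => h' x i⟩⟩, u, c, h⟩
    · rintro ⟨⟨A, hu, h'⟩, u, c, h⟩
      choose v hv using h'
      exact ⟨A, u, v, c, hu, h, fun x i => hv i x⟩
  · obtain ⟨C, rfl⟩ := (constFuns Ω).mkQ_surjective w
    let b := Module.finBasisOfFinrankEq ℝ W hW
    choose f hf using fun i => (constFuns Ω).mkQ_surjective (b i : (Ω → ℝ) ⧸ constFuns Ω)
    have hcomp : componentClass (fun x i => f i x) = W.subtype ∘ b := funext hf
    refine ⟨C, fun x i => f i x, ?_, ?_⟩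
    · rw [isMinimal_iff_linearIndependent, hcomp]
      exact b.linearIndependent.map' _ W.ker_subtype
    · rw [affClass_eq, hcomp, Set.range_comp, Submodule.span_image, b.span_eq,
        Submodule.map_top, Submodule.range_subtype]
end

section
/- If the pair (C,F) is minimal, then the parametrization map θ ↦ p_{C,F}(·;θ) from ℝⁿ to the exponential family E_{C,F} is a bijection; in particular it is injective: if p_{C,F}(x;θ) = p_{C,F}(x;θ') for all x ∈ Ω, then θ = θ'. -/
open scoped BigOperators

/-- In a minimal exponential family the density determines the parameter. -/
theorem expPdf_injective {Ω : Type*} [Fintype Ω] {n : ℕ}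
    (C : Ω → ℝ) (F : Ω → Fin n → ℝ) (hF : IsMinimal F) :
    Function.Injective (expPdf C F) := by
  intro θ θ' h
  have hzero := Fintype.linearIndependent_iff.mp hF
    (Fin.cons (logPartition C F θ' - logPartition C F θ) (fun i => θ i - θ' i)) (by
      funext x
      have hx := Real.exp_injective (congrFun h x)
      simp only [Fin.sum_univ_succ, Fin.cons_zero, Fin.cons_succ, Finset.sum_apply,
        Pi.smul_apply, smul_eq_mul, sub_mul, Finset.sum_sub_distrib,
        Pi.zero_apply]
      linarith)
  funext i
  simpa [sub_eq_zero] using hzero i.succ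

/-- If `(C,F)` is minimal, the parametrization `θ ↦ p_{C,F}(·;θ)` is a bijection from
`ℝⁿ` onto `E_{C,F}`; in particular it is injective. -/
theorem expFam_parametrization_bijective {Ω : Type*} [Fintype Ω] [Nonempty Ω] {n : ℕ}
    (C : Ω → ℝ) (F : Ω → Fin n → ℝ) (hF : IsMinimal F) :
    Set.BijOn (fun θ : Fin n → ℝ => fun x => expPdf C F θ x) Set.univ (expFam C F) ∧
    (∀ θ θ' : Fin n → ℝ, (∀ x : Ω, expPdf C F θ x = expPdf C F θ' x) → θ = θ') := by
  have hinj := expPdf_injective C F hF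
  refine ⟨⟨?_, hinj.injOn, ?_⟩, fun θ θ' h => hinj (funext h)⟩
  · exact fun θ _ => ⟨θ, rfl⟩
  · rintro _ ⟨θ, rfl⟩
    exact ⟨θ, trivial, rfl⟩
end
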